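/- For all n ≥ 0, the Hankel determinant of the sequence ((2^{2k+2} − 1)·B_{2k+2})_{k≥0} equals ((n+1)!/2^{n+1}) · Π_{ℓ=1}^{n} (ℓ!)^4, i.e., det_{0≤i,j≤n}((2^{2(i+j)+2} − 1) B_{2(i+j)+2}) = ((n+1)!/2^{n+1}) Π_{ℓ=1}^{n} (ℓ!)^4. -/

import Mathlib

/-- The `n`-th Hankel determinant of a sequence `c`. -/
noncomputable def hankel {R : Type*} [CommRing R] (c : ℕ → R) (n : ℕ) : R :=
  (Matrix.of fun i j : Fin (n + 1) => c (i.1 + j.1)).det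

open Polynomial in
/-- The linear functional on `ℚ[X]` sending `X ^ m` to `(2 ^ m - 1) * bernoulli m`. -/
noncomputable def genocchiFunctional : ℚ[X] →ₗ[ℚ] ℚ :=
  Polynomial.lsum fun m => (((2 : ℚ) ^ m - 1) * _root_.bernoulli m) • LinearMap.id

open Polynomial in
theorem genocchiFunctional_X_pow (m : ℕ) :
    genocchiFunctional (X ^ m) = ((2 : ℚ) ^ m - 1) * _root_.bernoulli m := by
  rw [genocchiFunctional, Polynomial.lsum_apply, ← Polynomial.monomial_one_right_eq_X_pow,
    Polynomial.sum_monomial_index] <;> simp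

open PowerSeries in
theorem rescale_sub_bernoulliPowerSeries_mul_exp_add_one :
    (rescale (2 : ℚ) (bernoulliPowerSeries ℚ) - bernoulliPowerSeries ℚ) * (exp ℚ + 1) = -X := by
  have h1 := bernoulliPowerSeries_mul_exp_sub_one ℚ
  have h2 := congrArg (rescale (2 : ℚ)) h1
  have h3 : rescale (2 : ℚ) (exp ℚ) = exp ℚ ^ 2 := by
    rw [exp_pow_eq_rescale_exp]; norm_num
  have h4 : (C (2 : ℚ) : PowerSeries ℚ) = 2 := map_ofNat _ 2
  rw [map_mul, map_sub, map_one, h3, rescale_X, h4] at h2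
  have h5 : exp ℚ - 1 ≠ 0 := by
    intro h
    rw [h, mul_zero] at h1
    exact X_ne_zero h1.symm
  apply mul_right_cancel₀ h5
  linear_combination h2 - (exp ℚ + 1) * h1

theorem sum_choose_mul_two_pow_sub_one_mul_bernoulli (m : ℕ) :
    ∑ k ∈ Finset.range (m + 1), (m.choose k : ℚ) * (((2 : ℚ) ^ k - 1) * bernoulli k)
      + ((2 : ℚ) ^ m - 1) * bernoulli m = if m = 1 then -1 else 0 := by
  have h := congrArg (PowerSeries.coeff m) rescale_sub_bernoulliPowerSeries_mul_exp_add_one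
  have hm : (m.factorial : ℚ) ≠ 0 := by positivity
  rw [mul_add, mul_one, map_add, PowerSeries.coeff_mul,
    Finset.Nat.sum_antidiagonal_eq_sum_range_succ_mk] at h
  simp only [bernoulliPowerSeries, map_sub, map_neg, PowerSeries.coeff_rescale,
    PowerSeries.coeff_mk, PowerSeries.coeff_exp, PowerSeries.coeff_X, Algebra.algebraMap_self,
    RingHom.id_apply] at h
  have h' := congrArg (fun x => (m.factorial : ℚ) * x) h
  simp only [mul_add, Finset.mul_sum] at h'
  convert h' using 2
  · refine Finset.sum_congr rfl fun k hk => ?_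
    have hk : k ≤ m := by simpa [Nat.lt_succ_iff] using hk
    rw [Nat.cast_choose ℚ hk]
    field_simp
  · field_simp
  · split_ifs with hm1
    · simp [hm1]
    · simp

open Polynomial in
theorem genocchiFunctional_taylor_add (p : ℚ[X]) :
    genocchiFunctional (taylor 1 p + p) = -(derivative p).eval 0 := by
  induction p using Polynomial.induction_on' with
  | add p q hp hq =>
    rw [map_add] at *
    simp only [map_add, eval_add] at *
    linarith
  | monomial n a =>
    have h := sum_choose_mul_two_pow_sub_one_mul_bernoulli n
    rw [← C_mul_X_pow_eq_monomial, ← smul_eq_C_mul, map_smul, ← smul_add, map_smul,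
      derivative_smul, eval_smul, taylor_X_pow, map_add, genocchiFunctional_X_pow, C_1, add_pow,
      map_sum, derivative_X_pow]
    have : ∀ k ∈ Finset.range (n + 1),
        genocchiFunctional (X ^ k * 1 ^ (n - k) * (n.choose k : ℚ[X]))
          = (n.choose k : ℚ) * (((2 : ℚ) ^ k - 1) * _root_.bernoulli k) := by
      intro k _
      rw [one_pow, mul_one, ← C_eq_natCast, mul_comm, ← smul_eq_C_mul, map_smul,
        genocchiFunctional_X_pow, smul_eq_mul]
    rw [Finset.sum_congr rfl this, h]
    rcases n with _ | _ | n <;> simp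

open Polynomial in
/-- The even polynomial `∏_{l < m} (X² - l²)`. -/
noncomputable def centralProd (m : ℕ) : ℚ[X] :=
  ∏ l ∈ Finset.range m, (X ^ 2 - (l : ℚ[X]) ^ 2)

open Polynomial in
/-- The polynomial `∏_{-m < l ≤ m} (X - l)`. -/
noncomputable def shiftedCentralProd (m : ℕ) : ℚ[X] :=
  ∏ l ∈ Finset.range m, ((X - ((l : ℚ[X]) + 1)) * (X + (l : ℚ[X])))

open Polynomial in
theorem X_mul_shiftedCentralProd (m : ℕ) :
    X * shiftedCentralProd m = (X - (m : ℚ[X])) * centralProd m := by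
  induction m with
  | zero => simp [shiftedCentralProd, centralProd]
  | succ m ih =>
    rw [shiftedCentralProd, Finset.prod_range_succ, ← shiftedCentralProd, centralProd,
      Finset.prod_range_succ, ← centralProd]
    push_cast
    linear_combination (X - ((m : ℚ[X]) + 1)) * (X + (m : ℚ[X])) * ih

open Polynomial in
theorem X_mul_taylor_shiftedCentralProd (m : ℕ) :
    X * taylor 1 (shiftedCentralProd m) = (X + (m : ℚ[X])) * centralProd m := by
  induction m with
  | zero => simp [shiftedCentralProd, centralProd]
  | succ m ih =>
    rw [shiftedCentralProd, Finset.prod_range_succ, ← shiftedCentralProd, centralProd,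
      Finset.prod_range_succ, ← centralProd, taylor_mul]
    have : taylor (1 : ℚ) ((X - ((m : ℚ[X]) + 1)) * (X + (m : ℚ[X])))
        = (X - (m : ℚ[X])) * (X + (m : ℚ[X]) + 1) := by
      simp only [taylor_apply, mul_comp, sub_comp, add_comp, X_comp, natCast_comp, one_comp, C_1]
      ring
    rw [this]
    push_cast
    linear_combination (X - (m : ℚ[X])) * (X + (m : ℚ[X]) + 1) * ih

open Polynomial in
theorem taylor_shiftedCentralProd_add (m : ℕ) :
    taylor 1 (shiftedCentralProd m) + shiftedCentralProd m = (2 : ℚ) • centralProd m := by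
  apply mul_left_cancel₀ (X_ne_zero (R := ℚ))
  have : (C (2 : ℚ) : ℚ[X]) = 2 := map_ofNat _ 2
  rw [smul_eq_C_mul, this]
  linear_combination X_mul_shiftedCentralProd m + X_mul_taylor_shiftedCentralProd m

open Polynomial in
theorem eval_zero_derivative_shiftedCentralProd (m : ℕ) :
    (shiftedCentralProd (m + 1)).eval 0 = 0 ∧
    (derivative (shiftedCentralProd (m + 1))).eval 0
      = (-1) ^ (m + 1) * (m.factorial : ℚ) * ((m + 1).factorial : ℚ) := by
  induction m with
  | zero => simp [shiftedCentralProd]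
  | succ m ih =>
    rw [shiftedCentralProd, Finset.prod_range_succ, ← shiftedCentralProd]
    refine ⟨by simp [ih.1], ?_⟩
    rw [derivative_mul, eval_add, eval_mul, eval_mul, eval_mul, ih.1, ih.2]
    simp [Nat.factorial_succ]
    ring

theorem genocchiFunctional_centralProd (m : ℕ) :
    genocchiFunctional (centralProd (m + 1))
      = (-1) ^ m / 2 * (m.factorial : ℚ) * ((m + 1).factorial : ℚ) := by
  have h := genocchiFunctional_taylor_add (shiftedCentralProd (m + 1))
  rw [taylor_shiftedCentralProd_add, map_smul,
    (eval_zero_derivative_shiftedCentralProd m).2, smul_eq_mul] at h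
  rw [pow_succ] at h
  linarith

open Polynomial in
theorem genocchiFunctional_centralProd_mul (i j : ℕ) :
    genocchiFunctional (centralProd i * centralProd (j + 1))
      = (-1) ^ (i + j) / 2 * ((i + j).factorial : ℚ) * (i.factorial : ℚ)
        * ((j + 1).factorial : ℚ) := by
  induction i generalizing j with
  | zero =>
    have : centralProd 0 = 1 := by simp [centralProd]
    rw [this, one_mul, genocchiFunctional_centralProd]
    simp
  | succ i ih =>
    have h : centralProd (i + 1) * centralProd (j + 1)
        = centralProd i * centralProd (j + 1 + 1)
          + (((j : ℚ) + 1) ^ 2 - (i : ℚ) ^ 2) • (centralProd i * centralProd (j + 1)) := by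
      have hc : ∀ k, centralProd (k + 1) = centralProd k * (X ^ 2 - (k : ℚ[X]) ^ 2) := fun k => by
        rw [centralProd, Finset.prod_range_succ, ← centralProd]
      rw [hc i, hc (j + 1), smul_eq_C_mul]
      simp only [C_sub, C_pow, C_add, C_1, map_natCast, Nat.cast_add, Nat.cast_one]
      ring
    rw [h, map_add, map_smul, ih, ih, show i + (j + 1) = i + j + 1 by ring,
      show i + 1 + j = i + j + 1 by ring]
    simp only [Nat.factorial_succ, smul_eq_mul, pow_succ]
    push_cast
    ring

open Polynomial in
/-- The Gram matrix of two monic polynomial families has the same determinant as the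
moment matrix. -/
theorem det_gram_eq_det_moments {R : Type*} [CommRing R] {n : ℕ} (φ : R[X] →ₗ[R] R)
    (p q : Fin n → R[X]) (hp : ∀ i, (p i).natDegree = i) (hpm : ∀ i, (p i).Monic)
    (hq : ∀ i, (q i).natDegree = i) (hqm : ∀ i, (q i).Monic) :
    (Matrix.of fun i j : Fin n => φ (p i * q j)).det
      = (Matrix.of fun i j : Fin n => φ (X ^ (i.1 + j.1))).det := by
  have hsum : ∀ r : Fin n → R[X], (∀ i, (r i).natDegree = i) →
      ∀ i, r i = ∑ a : Fin n, C ((r i).coeff a) * X ^ (a : ℕ) := by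
    intro r hr i
    rw [Fin.sum_univ_eq_sum_range (fun a => C ((r i).coeff a) * X ^ a) n]
    exact as_sum_range_C_mul_X_pow' _ (by rw [hr]; exact i.2)
  have key : (Matrix.of fun i j : Fin n => φ (p i * q j))
      = (Matrix.of fun a i : Fin n => (p i).coeff a).transpose
        * (Matrix.of fun i j : Fin n => φ (X ^ (i.1 + j.1)))
        * (Matrix.of fun b j : Fin n => (q j).coeff b) := by
    ext i j
    rw [Matrix.of_apply]
    conv_lhs => rw [hsum p hp i, hsum q hq j]
    simp only [Matrix.mul_apply, Matrix.transpose_apply, Matrix.of_apply, Finset.sum_mul,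
      Finset.mul_sum, map_sum]
    refine Finset.sum_congr rfl fun b _ => Finset.sum_congr rfl fun a _ => ?_
    have : C ((p i).coeff a) * X ^ (a : ℕ) * (C ((q j).coeff b) * X ^ (b : ℕ))
        = ((p i).coeff a * (q j).coeff b) • (X : R[X]) ^ (a.1 + b.1) := by
      rw [smul_eq_C_mul, C_mul, pow_add]
      ring
    rw [this, map_smul, smul_eq_mul]
    ring
  rw [key, Matrix.det_mul, Matrix.det_mul, Matrix.det_transpose,
    Matrix.det_matrixOfPolynomials p hp hpm, Matrix.det_matrixOfPolynomials q hq hqm, one_mul,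
    mul_one]

theorem add_choose_eq_sum_choose_mul_choose (i j n : ℕ) (hi : i < n) :
    (i + j).choose i = ∑ k ∈ Finset.range n, i.choose k * j.choose k := by
  rw [Nat.add_choose_eq, ← Finset.Nat.sum_antidiagonal_swap,
    Finset.Nat.sum_antidiagonal_eq_sum_range_succ_mk]
  have hsub : Finset.range (i + 1) ⊆ Finset.range n := Finset.range_subset_range.2 hi
  rw [← Finset.sum_subset hsub]
  · refine Finset.sum_congr rfl fun k hk => ?_
    have hk : k ≤ i := by simpa [Nat.lt_succ_iff] using hk
    simp [Nat.choose_symm hk]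
  · intro k _ hk
    have hk : i < k := by simpa [Nat.lt_succ_iff] using hk
    simp [Nat.choose_eq_zero_of_lt hk]

theorem det_mul_mul_factorial_add {R : Type*} [CommRing R] (n : ℕ) (u v : ℕ → R) :
    (Matrix.of fun i j : Fin n => u i * v j * ((i.1 + j.1).factorial : R)).det
      = ∏ i ∈ Finset.range n, u i * v i * (i.factorial : R) ^ 2 := by
  have key : (Matrix.of fun i j : Fin n => u i * v j * ((i.1 + j.1).factorial : R))
      = (Matrix.of fun i k : Fin n => u i * (i.1.factorial : R) * (i.1.choose k.1 : R))
        * (Matrix.of fun k j : Fin n => v j * (j.1.factorial : R) * (j.1.choose k.1 : R)) := by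
    ext i j
    simp only [Matrix.mul_apply, Matrix.of_apply]
    have h := add_choose_eq_sum_choose_mul_choose i.1 j.1 n i.2
    have hf := Nat.add_choose_mul_factorial_mul_factorial i.1 j.1
    rw [← Nat.choose_symm_add, h, ← Fin.sum_univ_eq_sum_range (fun k => i.1.choose k * j.1.choose k) n] at hf
    rw [← hf]
    push_cast
    simp only [Finset.mul_sum, Finset.sum_mul]
    exact Finset.sum_congr rfl fun k _ => by ring
  rw [key, Matrix.det_mul, Matrix.det_of_isLowerTriangular, Matrix.det_of_isUpperTriangular]
  · rw [← Finset.prod_mul_distrib, ← Fin.prod_univ_eq_prod_range]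
    refine Finset.prod_congr rfl fun i _ => ?_
    simp only [Matrix.of_apply, Nat.choose_self, Nat.cast_one]
    ring
  · intro i j hij
    have hij : j.1 < i.1 := hij
    simp [Nat.choose_eq_zero_of_lt hij]
  · intro i j hij
    have hij : i.1 < j.1 := hij
    simp [Nat.choose_eq_zero_of_lt hij]

open Polynomial in
/-- The linear functional on `ℚ[X]` sending `X ^ k` to
`(2 ^ (2 * k + 2) - 1) * bernoulli (2 * k + 2)`. -/
noncomputable def evenGenocchiFunctional : ℚ[X] →ₗ[ℚ] ℚ :=
  genocchiFunctional ∘ₗ LinearMap.mulLeft ℚ (X ^ 2) ∘ₗ (expand ℚ 2).toLinearMap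

open Polynomial in
theorem evenGenocchiFunctional_apply (p : ℚ[X]) :
    evenGenocchiFunctional p = genocchiFunctional (X ^ 2 * expand ℚ 2 p) :=
  rfl

open Polynomial in
theorem evenGenocchiFunctional_X_pow (k : ℕ) :
    evenGenocchiFunctional (X ^ k)
      = ((2 : ℚ) ^ (2 * k + 2) - 1) * _root_.bernoulli (2 * k + 2) := by
  rw [evenGenocchiFunctional_apply, map_pow, expand_X, ← pow_mul, ← pow_add,
    genocchiFunctional_X_pow, add_comm 2 (2 * _)]

open Polynomial in
theorem evenGenocchiFunctional_prod_mul_prod (i j : ℕ) :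
    evenGenocchiFunctional ((∏ l ∈ Finset.range i, (X - C ((l : ℚ) ^ 2)))
        * ∏ l ∈ Finset.range j, (X - C (((l : ℚ) + 1) ^ 2)))
      = ((-1) ^ i * (i.factorial : ℚ)) * ((-1) ^ j / 2 * ((j + 1).factorial : ℚ))
        * ((i + j).factorial : ℚ) := by
  have h1 : expand ℚ 2 (∏ l ∈ Finset.range i, (X - C ((l : ℚ) ^ 2))) = centralProd i := by
    simp [centralProd, map_prod]
  have h2 : X ^ 2 * expand ℚ 2 (∏ l ∈ Finset.range j, (X - C (((l : ℚ) + 1) ^ 2)))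
      = centralProd (j + 1) := by
    rw [centralProd, Finset.prod_range_succ', mul_comm]
    simp [map_prod]
  rw [evenGenocchiFunctional_apply, map_mul (expand ℚ 2), h1, mul_left_comm, h2,
    genocchiFunctional_centralProd_mul, pow_add]
  ring

open Polynomial in
theorem det_evenGenocchiFunctional_X_pow (n : ℕ) :
    (Matrix.of fun i j : Fin n => evenGenocchiFunctional (X ^ (i.1 + j.1))).det
      = ∏ i ∈ Finset.range n, ((-1) ^ i * (i.factorial : ℚ))
          * ((-1) ^ i / 2 * ((i + 1).factorial : ℚ)) * (i.factorial : ℚ) ^ 2 := by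
  have hnd : ∀ (c : ℕ → ℚ) (m : ℕ), (∏ l ∈ Finset.range m, (X - C (c l))).natDegree = m :=
    fun c m => by simp
  have hmon : ∀ (c : ℕ → ℚ) (m : ℕ), (∏ l ∈ Finset.range m, (X - C (c l))).Monic :=
    fun c m => monic_prod_of_monic _ _ fun l _ => monic_X_sub_C _
  rw [← det_gram_eq_det_moments evenGenocchiFunctional
    (fun i => ∏ l ∈ Finset.range i.1, (X - C ((l : ℚ) ^ 2)))
    (fun j => ∏ l ∈ Finset.range j.1, (X - C (((l : ℚ) + 1) ^ 2)))
    (fun i => hnd _ i) (fun i => hmon _ i) (fun i => hnd _ i) (fun i => hmon _ i)]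
  simp only [evenGenocchiFunctional_prod_mul_prod]
  exact det_mul_mul_factorial_add n (fun i => (-1) ^ i * (i.factorial : ℚ))
    (fun j => (-1) ^ j / 2 * ((j + 1).factorial : ℚ))

theorem hankel_two_pow_bernoulli (n : ℕ) :
    hankel (fun k => ((2 : ℚ) ^ (2 * k + 2) - 1) * bernoulli (2 * k + 2)) n
      = ((Nat.factorial (n + 1) : ℚ) / 2 ^ (n + 1)) *
          ∏ ℓ ∈ Finset.Icc 1 n, (Nat.factorial ℓ : ℚ) ^ 4 := by
  simp only [hankel, ← evenGenocchiFunctional_X_pow]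
  rw [det_evenGenocchiFunctional_X_pow]
  induction n with
  | zero => simp
  | succ n ih =>
    rw [Finset.prod_range_succ, ih, Finset.prod_Icc_succ_top (by omega),
      Nat.factorial_succ (n + 1)]
    have h : ((-1 : ℚ) ^ (n + 1)) ^ 2 = 1 := by
      rw [← pow_mul, mul_comm, pow_mul]; norm_num
    rw [pow_succ (2 : ℚ) (n + 1)]
    push_cast
    generalize (-1 : ℚ) ^ (n + 1) = e at h
    field_simp
    rw [h]
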